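/- Let α : ℝ → ℝ be continuous and positive, L > 0, and let ψ be concave and positive on (0,L/2). Then for each t ≥ 0, the minimal supersolution ψ₊(·,t) is a concave function on (0,L/2). -/

import Mathlib

open Set Real Filter

/-- Partial derivative in the spatial variable. -/
noncomputable def pderivX (u : ℝ → ℝ → ℝ) (x t : ℝ) : ℝ := deriv (fun y => u y t) x

/-- Second partial derivative in the spatial variable. -/
noncomputable def pderivXX (u : ℝ → ℝ → ℝ) (x t : ℝ) : ℝ := deriv (fun y => pderivX u y t) x

/-- Partial derivative in the time variable. -/
noncomputable def pderivT (u : ℝ → ℝ → ℝ) (x t : ℝ) : ℝ := deriv (fun s => u x s) t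

/-- `u` is regular on `S`: it is continuous, has spatial derivatives up to second order and a
first time derivative on `S`, and these are continuous on `S`. -/
def RegularOn (u : ℝ → ℝ → ℝ) (S : Set (ℝ × ℝ)) : Prop :=
  ContinuousOn (fun p : ℝ × ℝ => u p.1 p.2) S ∧
  (∀ p ∈ S, DifferentiableAt ℝ (fun y => u y p.2) p.1) ∧
  (∀ p ∈ S, DifferentiableAt ℝ (fun y => pderivX u y p.2) p.1) ∧
  (∀ p ∈ S, DifferentiableAt ℝ (fun s => u p.1 s) p.2) ∧
  ContinuousOn (fun p : ℝ × ℝ => pderivX u p.1 p.2) S ∧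
  ContinuousOn (fun p : ℝ × ℝ => pderivXX u p.1 p.2) S ∧
  ContinuousOn (fun p : ℝ × ℝ => pderivT u p.1 p.2) S

/-- `ψ` is a modulus of continuity for the `L`-periodic function `u`. -/
def IsModulus (L : ℝ) (ψ : ℝ → ℝ) (u : ℝ → ℝ) : Prop :=
  ∀ x y : ℝ, 0 < y - x → y - x < L →
    -(2 * ψ ((L + x - y) / 2)) ≤ u y - u x ∧ u y - u x ≤ 2 * ψ ((y - x) / 2)

/-- Membership in the class `S_ψ` of supersolutions of `∂ₜφ = α(φ')φ''` on
`[0, L/2] × [0, ∞)` lying above `ψ` at time `0`. -/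
def MemS (α : ℝ → ℝ) (L : ℝ) (ψ : ℝ → ℝ) (φ : ℝ → ℝ → ℝ) : Prop :=
  (∀ z t : ℝ, z ∈ Icc 0 (L/2) → 0 ≤ t → 0 ≤ φ z t) ∧
  ContinuousOn (fun p : ℝ × ℝ => φ p.1 p.2)
    ((Icc 0 (L/2) ×ˢ Ici 0) \ {((0:ℝ), (0:ℝ)), ((L/2 : ℝ), (0:ℝ))}) ∧
  RegularOn φ (Ioo 0 (L/2) ×ˢ Ioi 0) ∧
  (∀ z t : ℝ, z ∈ Ioo 0 (L/2) → 0 < t →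
    α (pderivX φ z t) * pderivXX φ z t ≤ pderivT φ z t) ∧
  (∀ z ∈ Ioo (0:ℝ) (L/2), ψ z ≤ φ z 0)

/-- The minimal supersolution `ψ₊`. -/
noncomputable def psiPlus (α : ℝ → ℝ) (L : ℝ) (ψ : ℝ → ℝ) (z t : ℝ) : ℝ :=
  sInf {y : ℝ | ∃ φ : ℝ → ℝ → ℝ, MemS α L ψ φ ∧ φ z t = y}

/-- A `C¹` profile equal to `1` on `(-∞, 0]` and decaying like a Gaussian on `[0, ∞)`. -/
noncomputable def gaussProfile (n s : ℝ) : ℝ := exp (-(n * max s 0) ^ 2)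

/-- The primitive of `gaussProfile`: the identity on `(-∞, 0]`, concave and at most `π / (2 n)`. -/
noncomputable def softCap (n s : ℝ) : ℝ := ∫ u in (0 : ℝ)..s, gaussProfile n u

lemma gaussProfile_pos (n s : ℝ) : 0 < gaussProfile n s := exp_pos _

lemma gaussProfile_le_one (n s : ℝ) : gaussProfile n s ≤ 1 :=
  exp_le_one_iff.2 (neg_nonpos.2 (sq_nonneg _))

lemma gaussProfile_of_nonpos (n : ℝ) {s : ℝ} (hs : s ≤ 0) : gaussProfile n s = 1 := by
  simp [gaussProfile, max_eq_right hs]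

lemma continuous_gaussProfile (n : ℝ) : Continuous (gaussProfile n) := by
  unfold gaussProfile; fun_prop

lemma one_sub_gaussProfile_le (n s : ℝ) : 1 - gaussProfile n s ≤ (n * max s 0) ^ 2 := by
  have := add_one_le_exp (-(n * max s 0) ^ 2)
  unfold gaussProfile; linarith

lemma hasDerivAt_max_zero_sq (s : ℝ) : HasDerivAt (fun x : ℝ => (max x 0) ^ 2) (2 * max s 0) s := by
  rcases lt_trichotomy s 0 with hs | rfl | hs
  · rw [max_eq_right hs.le, mul_zero]
    refine (hasDerivAt_const s (0 : ℝ)).congr_of_eventuallyEq ?_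
    filter_upwards [Iio_mem_nhds hs] with x hx
    simp [max_eq_right (mem_Iio.1 hx).le]
  · rw [hasDerivAt_iff_isLittleO]
    simp only [max_self, mul_zero, smul_zero, sub_zero, ne_eq, OfNat.ofNat_ne_zero,
      not_false_eq_true, zero_pow]
    have h : (fun x : ℝ => (max x 0) ^ 2) =O[nhds 0] fun x : ℝ => x ^ 2 := by
      refine Asymptotics.IsBigO.of_bound 1 (Eventually.of_forall fun x => ?_)
      rw [one_mul, norm_pow, norm_pow]
      refine pow_le_pow_left₀ (norm_nonneg _) ?_ 2
      rw [Real.norm_of_nonneg (le_max_right x 0)]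
      exact max_le (le_abs_self x) (abs_nonneg x)
    exact h.trans_isLittleO (by simpa using Asymptotics.isLittleO_pow_pow (𝕜 := ℝ) one_lt_two)
  · rw [max_eq_left hs.le]
    have := (hasDerivAt_pow 2 s)
    simp only [Nat.cast_ofNat, Nat.add_one_sub_one, pow_one] at this
    refine this.congr_of_eventuallyEq ?_
    filter_upwards [Ioi_mem_nhds hs] with x hx
    rw [max_eq_left (mem_Ioi.1 hx).le]

lemma hasDerivAt_gaussProfile (n s : ℝ) :
    HasDerivAt (gaussProfile n) (-(2 * n ^ 2 * max s 0) * gaussProfile n s) s := by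
  have h := (((hasDerivAt_max_zero_sq s).const_mul (n ^ 2)).neg).exp
  have e : gaussProfile n = fun x => exp (-(n ^ 2 * (max x 0) ^ 2)) := by
    funext x; simp only [gaussProfile, mul_pow]
  rw [e]
  refine h.congr_deriv ?_
  simp only [Pi.neg_apply]
  ring

lemma hasDerivAt_softCap (n s : ℝ) : HasDerivAt (softCap n) (gaussProfile n s) s :=
  ((continuous_gaussProfile n).integral_hasStrictDerivAt 0 s).hasDerivAt

lemma continuous_softCap (n : ℝ) : Continuous (softCap n) :=
  continuous_iff_continuousAt.2 fun s => (hasDerivAt_softCap n s).continuousAt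

lemma softCap_of_nonpos (n : ℝ) {s : ℝ} (hs : s ≤ 0) : softCap n s = s := by
  have : softCap n s = ∫ _ in (0 : ℝ)..s, (1 : ℝ) := by
    refine intervalIntegral.integral_congr fun u hu => ?_
    rw [uIcc_of_ge hs] at hu
    exact gaussProfile_of_nonpos n hu.2
  simpa using this

lemma softCap_pos (n : ℝ) {s : ℝ} (hs : 0 < s) : 0 < softCap n s :=
  intervalIntegral.intervalIntegral_pos_of_pos
    ((continuous_gaussProfile n).intervalIntegrable _ _) (gaussProfile_pos n) hs

lemma softCap_nonneg (n : ℝ) {s : ℝ} (hs : 0 ≤ s) : 0 ≤ softCap n s := by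
  rcases hs.eq_or_lt with rfl | h
  · simp [softCap]
  · exact (softCap_pos n h).le

lemma softCap_lt {n : ℝ} (hn : 0 < n) (s : ℝ) : softCap n s < π / 2 / n := by
  rcases le_or_gt s 0 with hs | hs
  · rw [softCap_of_nonpos n hs]
    exact hs.trans_lt (by positivity)
  have h1 : softCap n s ≤ ∫ u in (0 : ℝ)..s, (1 + (n * u) ^ 2)⁻¹ := by
    have hc : Continuous fun u : ℝ => (1 + (n * u) ^ 2)⁻¹ :=
      Continuous.inv₀ (by fun_prop) fun u => by positivity
    refine intervalIntegral.integral_mono_on hs.le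
      ((continuous_gaussProfile n).intervalIntegrable _ _) (hc.intervalIntegrable _ _)
      fun u hu => ?_
    rw [gaussProfile, max_eq_left hu.1, exp_neg]
    exact inv_anti₀ (by positivity) (by linarith [add_one_le_exp ((n * u) ^ 2)])
  have h2 : ∫ u in (0 : ℝ)..s, (1 + (n * u) ^ 2)⁻¹ = n⁻¹ * arctan (n * s) := by
    rw [intervalIntegral.integral_comp_mul_left (fun x => (1 + x ^ 2)⁻¹) hn.ne']
    simp
  rw [h2] at h1
  refine h1.trans_lt ?_
  rw [div_eq_inv_mul (π / 2)]
  exact mul_lt_mul_of_pos_left (arctan_lt_pi_div_two _) (inv_pos.2 hn)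

lemma softCap_le_self (n : ℝ) {s : ℝ} (hs : 0 ≤ s) : softCap n s ≤ s := by
  have : softCap n s ≤ ∫ _ in (0 : ℝ)..s, (1 : ℝ) :=
    intervalIntegral.integral_mono_on hs ((continuous_gaussProfile n).intervalIntegrable _ _)
      (continuous_const.intervalIntegrable _ _) fun u _ => gaussProfile_le_one n u
  simpa using this

lemma eventuallyEq_slice_left {f g : ℝ → ℝ → ℝ} {p : ℝ × ℝ}
    (h : ∀ᶠ q in nhds p, f q.1 q.2 = g q.1 q.2) :
    (fun y => f y p.2) =ᶠ[nhds p.1] fun y => g y p.2 := by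
  have hc : Tendsto (fun y : ℝ => (y, p.2)) (nhds p.1) (nhds p) :=
    (Continuous.prodMk continuous_id continuous_const).tendsto' _ _ rfl
  exact hc.eventually h

lemma eventuallyEq_slice_right {f g : ℝ → ℝ → ℝ} {p : ℝ × ℝ}
    (h : ∀ᶠ q in nhds p, f q.1 q.2 = g q.1 q.2) :
    (fun s => f p.1 s) =ᶠ[nhds p.2] fun s => g p.1 s := by
  have hc : Tendsto (fun s : ℝ => (p.1, s)) (nhds p.2) (nhds p) :=
    (Continuous.prodMk continuous_const continuous_id).tendsto' _ _ rfl
  exact hc.eventually h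

lemma pderivX_congr {f g : ℝ → ℝ → ℝ} {p : ℝ × ℝ}
    (h : ∀ᶠ q in nhds p, f q.1 q.2 = g q.1 q.2) :
    ∀ᶠ q in nhds p, pderivX f q.1 q.2 = pderivX g q.1 q.2 := by
  filter_upwards [h.eventually_nhds] with q hq
  exact (eventuallyEq_slice_left hq).deriv_eq

lemma pderivXX_congr {f g : ℝ → ℝ → ℝ} {p : ℝ × ℝ}
    (h : ∀ᶠ q in nhds p, f q.1 q.2 = g q.1 q.2) :
    ∀ᶠ q in nhds p, pderivXX f q.1 q.2 = pderivXX g q.1 q.2 :=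
  pderivX_congr (pderivX_congr h)

lemma pderivT_congr {f g : ℝ → ℝ → ℝ} {p : ℝ × ℝ}
    (h : ∀ᶠ q in nhds p, f q.1 q.2 = g q.1 q.2) :
    ∀ᶠ q in nhds p, pderivT f q.1 q.2 = pderivT g q.1 q.2 := by
  filter_upwards [h.eventually_nhds] with q hq
  exact (eventuallyEq_slice_right hq).deriv_eq

lemma RegularOn.mono {u : ℝ → ℝ → ℝ} {S T : Set (ℝ × ℝ)} (h : RegularOn u S) (hT : T ⊆ S) :
    RegularOn u T :=
  ⟨h.1.mono hT, fun p hp => h.2.1 p (hT hp), fun p hp => h.2.2.1 p (hT hp),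
    fun p hp => h.2.2.2.1 p (hT hp), h.2.2.2.2.1.mono hT, h.2.2.2.2.2.1.mono hT,
    h.2.2.2.2.2.2.mono hT⟩

/-- Regularity on an open set is a local property. -/
lemma RegularOn.of_locally_eq {u : ℝ → ℝ → ℝ} {S : Set (ℝ × ℝ)} (hS : IsOpen S)
    (h : ∀ p ∈ S, ∃ w : ℝ → ℝ → ℝ, RegularOn w S ∧ ∀ᶠ q in nhds p, u q.1 q.2 = w q.1 q.2) :
    RegularOn u S := by
  refine ⟨fun p hp => ?_, fun p hp => ?_, fun p hp => ?_, fun p hp => ?_, fun p hp => ?_,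
    fun p hp => ?_, fun p hp => ?_⟩ <;> obtain ⟨w, hw, he⟩ := h p hp
  · exact ((hw.1.continuousAt (hS.mem_nhds hp)).congr
      (he.mono fun q hq => hq.symm)).continuousWithinAt
  · exact (hw.2.1 p hp).congr_of_eventuallyEq (eventuallyEq_slice_left he)
  · exact (hw.2.2.1 p hp).congr_of_eventuallyEq (eventuallyEq_slice_left (pderivX_congr he))
  · exact (hw.2.2.2.1 p hp).congr_of_eventuallyEq (eventuallyEq_slice_right he)
  · exact ((hw.2.2.2.2.1.continuousAt (hS.mem_nhds hp)).congr
      ((pderivX_congr he).mono fun q hq => hq.symm)).continuousWithinAt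
  · exact ((hw.2.2.2.2.2.1.continuousAt (hS.mem_nhds hp)).congr
      ((pderivXX_congr he).mono fun q hq => hq.symm)).continuousWithinAt
  · exact ((hw.2.2.2.2.2.2.continuousAt (hS.mem_nhds hp)).congr
      ((pderivT_congr he).mono fun q hq => hq.symm)).continuousWithinAt

/-- The derivatives of the composition of `u - (A + b x)` with `softCap`, re-centred at the affine
function `A + b x`. -/
lemma RegularOn.softCap_derivs {u : ℝ → ℝ → ℝ} {S : Set (ℝ × ℝ)}
    (hu : RegularOn u S) (n A b : ℝ) :
    (∀ p ∈ S, HasDerivAt (fun y => A + b * y + softCap n (u y p.2 - (A + b * y)))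
      (b + gaussProfile n (u p.1 p.2 - (A + b * p.1)) * (pderivX u p.1 p.2 - b)) p.1) ∧
    (∀ p ∈ S, HasDerivAt
      (fun y => b + gaussProfile n (u y p.2 - (A + b * y)) * (pderivX u y p.2 - b))
      (gaussProfile n (u p.1 p.2 - (A + b * p.1)) * (pderivXX u p.1 p.2 -
        2 * n ^ 2 * max (u p.1 p.2 - (A + b * p.1)) 0 * (pderivX u p.1 p.2 - b) ^ 2)) p.1) ∧
    (∀ p ∈ S, HasDerivAt (fun s => A + b * p.1 + softCap n (u p.1 s - (A + b * p.1)))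
      (gaussProfile n (u p.1 p.2 - (A + b * p.1)) * pderivT u p.1 p.2) p.2) := by
  have hv : ∀ p ∈ S, HasDerivAt (fun y => u y p.2 - (A + b * y)) (pderivX u p.1 p.2 - b) p.1 := by
    intro p hp
    have h1 : HasDerivAt (fun y => u y p.2) (pderivX u p.1 p.2) p.1 := (hu.2.1 p hp).hasDerivAt
    have h2 : HasDerivAt (fun y : ℝ => A + b * y) b p.1 := by
      simpa using ((hasDerivAt_id p.1).const_mul b).const_add A
    exact h1.sub h2
  refine ⟨fun p hp => ?_, fun p hp => ?_, fun p hp => ?_⟩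
  · have h2 : HasDerivAt (fun y : ℝ => A + b * y) b p.1 := by
      simpa using ((hasDerivAt_id p.1).const_mul b).const_add A
    exact h2.add ((hasDerivAt_softCap n _).comp p.1 (hv p hp))
  · have h1 : HasDerivAt (fun y => pderivX u y p.2) (pderivXX u p.1 p.2) p.1 :=
      (hu.2.2.1 p hp).hasDerivAt
    have h2 := (hasDerivAt_gaussProfile n _).comp p.1 (hv p hp)
    refine ((h2.mul (h1.sub_const b)).const_add b).congr_deriv ?_
    simp only [Function.comp]
    ring
  · have h1 : HasDerivAt (fun s => u p.1 s) (pderivT u p.1 p.2) p.2 := (hu.2.2.2.1 p hp).hasDerivAt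
    exact ((hasDerivAt_softCap n _).comp p.2 (h1.sub_const _)).const_add _

lemma RegularOn.softCap_pderivs {u : ℝ → ℝ → ℝ} {S : Set (ℝ × ℝ)} (hS : IsOpen S)
    (hu : RegularOn u S) (n A b : ℝ) :
    RegularOn (fun x t => A + b * x + softCap n (u x t - (A + b * x))) S ∧
    ∀ p ∈ S,
      pderivX (fun x t => A + b * x + softCap n (u x t - (A + b * x))) p.1 p.2 =
        b + gaussProfile n (u p.1 p.2 - (A + b * p.1)) * (pderivX u p.1 p.2 - b) ∧
      pderivXX (fun x t => A + b * x + softCap n (u x t - (A + b * x))) p.1 p.2 =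
        gaussProfile n (u p.1 p.2 - (A + b * p.1)) * (pderivXX u p.1 p.2 -
          2 * n ^ 2 * max (u p.1 p.2 - (A + b * p.1)) 0 * (pderivX u p.1 p.2 - b) ^ 2) ∧
      pderivT (fun x t => A + b * x + softCap n (u x t - (A + b * x))) p.1 p.2 =
        gaussProfile n (u p.1 p.2 - (A + b * p.1)) * pderivT u p.1 p.2 := by
  obtain ⟨h1, h2, h3⟩ := hu.softCap_derivs n A b
  have hX : ∀ p ∈ S, pderivX (fun x t => A + b * x + softCap n (u x t - (A + b * x))) p.1 p.2 =
      b + gaussProfile n (u p.1 p.2 - (A + b * p.1)) * (pderivX u p.1 p.2 - b) :=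
    fun p hp => (h1 p hp).deriv
  have hXe : ∀ p ∈ S,
      (fun y => pderivX (fun x t => A + b * x + softCap n (u x t - (A + b * x))) y p.2)
        =ᶠ[nhds p.1]
      fun y => b + gaussProfile n (u y p.2 - (A + b * y)) * (pderivX u y p.2 - b) := by
    intro p hp
    exact eventuallyEq_slice_left (g := fun y s => b + gaussProfile n (u y s - (A + b * y)) *
      (pderivX u y s - b)) (by filter_upwards [hS.mem_nhds hp] with q hq using hX q hq)
  have h2' := fun p hp => (h2 p hp).congr_of_eventuallyEq (hXe p hp)
  have hXX := fun p hp => (h2' p hp).deriv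
  have hT := fun p hp => (h3 p hp).deriv
  have cu := hu.1
  have cX := hu.2.2.2.2.1
  have cXX := hu.2.2.2.2.2.1
  have cT := hu.2.2.2.2.2.2
  have cv : ContinuousOn (fun p : ℝ × ℝ => u p.1 p.2 - (A + b * p.1)) S :=
    cu.sub (by fun_prop)
  have cg := (continuous_gaussProfile n).comp_continuousOn cv
  have cs := (continuous_softCap n).comp_continuousOn cv
  refine ⟨⟨?_, fun p hp => (h1 p hp).differentiableAt, fun p hp => (h2' p hp).differentiableAt,
    fun p hp => (h3 p hp).differentiableAt, ?_, ?_, ?_⟩,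
    fun p hp => ⟨hX p hp, hXX p hp, hT p hp⟩⟩
  · exact ContinuousOn.add (by fun_prop) cs
  · exact (continuousOn_const.add (cg.mul (cX.sub continuousOn_const))).congr hX
  · refine (cg.mul (cXX.sub ((continuousOn_const.mul (cv.sup continuousOn_const)).mul
      ((cX.sub continuousOn_const).pow 2)))).congr hXX
  · exact (cg.mul cT).congr hT

/-- Scalar form of the supersolution inequality for `softCap n (u - ℓ)`, for large `n`. -/
lemma exists_softCap_ineq {α : ℝ → ℝ} (hα : Continuous α) (hαpos : ∀ p, 0 < α p) (b : ℝ)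
    {ε B : ℝ} (hε : 0 < ε) (hB : 0 < B) :
    ∃ n₀ : ℝ, 0 < n₀ ∧ ∀ n, n₀ ≤ n → ∀ v q D τ : ℝ, |q| ≤ B → |D| ≤ B →
      α (b + q) * D + ε ≤ τ →
      α (b + gaussProfile n v * q) * (gaussProfile n v * (D - 2 * n ^ 2 * max v 0 * q ^ 2)) ≤
        gaussProfile n v * τ := by
  have hI : IsCompact (Icc (b - B) (b + B)) := isCompact_Icc
  have hne : (Icc (b - B) (b + B)).Nonempty := ⟨b, by constructor <;> linarith⟩
  obtain ⟨p₁, -, hp₁⟩ := hI.exists_isMinOn hne hα.continuousOn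
  obtain ⟨p₂, -, hp₂⟩ := hI.exists_isMaxOn hne hα.continuousOn
  have hmin : ∀ x ∈ Icc (b - B) (b + B), α p₁ ≤ α x := fun x hx => hp₁ hx
  have hmax : ∀ x ∈ Icc (b - B) (b + B), α x ≤ α p₂ := fun x hx => hp₂ hx
  obtain ⟨ρ, hρ, huc⟩ := Metric.uniformContinuousOn_iff.1
    (hI.uniformContinuousOn_of_continuous hα.continuousOn) (ε / B) (by positivity)
  have ha := hαpos p₁
  have hA := hαpos p₂
  set M : ℝ := α p₂ * B / (ρ ^ 2 * α p₁) with hM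
  have hM0 : 0 < M := by positivity
  refine ⟨M ^ 2 * B / ρ + 1, by positivity, fun n hn v q D τ hq hD hτ => ?_⟩
  have hg := gaussProfile_pos n v
  have hg1 := gaussProfile_le_one n v
  have hg2 := one_sub_gaussProfile_le n v
  set g := gaussProfile n v
  have hq' := abs_le.1 hq
  have hgq : |g * q| ≤ B := by
    rw [abs_mul, abs_of_pos hg]
    exact (mul_le_of_le_one_left (abs_nonneg q) hg1).trans hq
  have hgq' := abs_le.1 hgq
  have m1 : b + q ∈ Icc (b - B) (b + B) := ⟨by linarith, by linarith⟩
  have m2 : b + g * q ∈ Icc (b - B) (b + B) := ⟨by linarith, by linarith⟩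
  have hv0 : 0 ≤ max v 0 := le_max_right _ _
  set w := max v 0
  have hpen : 0 ≤ α (b + g * q) * (2 * n ^ 2 * w * q ^ 2) :=
    mul_nonneg (hαpos _).le (by positivity)
  suffices h : (α (b + g * q) - α (b + q)) * D ≤ ε + α (b + g * q) * (2 * n ^ 2 * w * q ^ 2) by
    have : α (b + g * q) * (D - 2 * n ^ 2 * w * q ^ 2) ≤ τ := by linarith
    calc _ = g * (α (b + g * q) * (D - 2 * n ^ 2 * w * q ^ 2)) := by ring
      _ ≤ g * τ := mul_le_mul_of_nonneg_left this hg.le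
  rcases lt_or_ge ((1 - g) * |q|) ρ with hlt | hge
  · have hd : dist (b + g * q) (b + q) < ρ := by
      rw [Real.dist_eq, show b + g * q - (b + q) = -((1 - g) * q) by ring, abs_neg, abs_mul,
        abs_of_nonneg (by linarith : 0 ≤ 1 - g)]
      exact hlt
    have h1 := huc _ m2 _ m1 hd
    rw [Real.dist_eq] at h1
    have : (α (b + g * q) - α (b + q)) * D ≤ ε / B * B := by
      refine (le_abs_self _).trans ?_
      rw [abs_mul]
      exact mul_le_mul h1.le hD (abs_nonneg _) (by positivity)
    rw [div_mul_cancel₀ _ hB.ne'] at this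
    linarith
  · have hqρ : ρ ≤ |q| := hge.trans (mul_le_of_le_one_left (abs_nonneg q) (by linarith))
    have hq2 : ρ ^ 2 ≤ q ^ 2 := by
      rw [← sq_abs q]; exact pow_le_pow_left₀ hρ.le hqρ 2
    have hρB : ρ ≤ (n * w) ^ 2 * B :=
      hge.trans (mul_le_mul (by linarith) hq (abs_nonneg _) (by positivity))
    have hn1 : 1 ≤ n := by
      have : 0 ≤ M ^ 2 * B / ρ := by positivity
      linarith
    have hn2 : M ^ 2 * B ≤ n ^ 2 * ρ := by
      have h1 : M ^ 2 * B / ρ ≤ n ^ 2 := by nlinarith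
      rwa [div_le_iff₀ hρ] at h1
    have hnw : M ≤ n ^ 2 * w := by
      have h1 : M ^ 2 * B ≤ (n ^ 2 * w) ^ 2 * B := by
        calc M ^ 2 * B ≤ n ^ 2 * ρ := hn2
          _ ≤ n ^ 2 * ((n * w) ^ 2 * B) := mul_le_mul_of_nonneg_left hρB (by positivity)
          _ = _ := by ring
      exact le_of_sq_le_sq (le_of_mul_le_mul_right h1 hB) (by positivity)
    have hbig : α p₂ * B ≤ α (b + g * q) * (n ^ 2 * w * q ^ 2) := by
      calc α p₂ * B = α p₁ * (M * ρ ^ 2) := by rw [hM]; field_simp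
        _ ≤ α (b + g * q) * (n ^ 2 * w * q ^ 2) := by
          refine mul_le_mul (hmin _ m2) ?_ (by positivity) (hαpos _).le
          exact mul_le_mul hnw hq2 (by positivity) (by positivity)
    have hsmall : (α (b + g * q) - α (b + q)) * D ≤ α p₂ * B := by
      refine (le_abs_self _).trans ?_
      rw [abs_mul]
      refine mul_le_mul ?_ hD (abs_nonneg _) hA.le
      rw [abs_le]
      constructor <;> linarith [hmax _ m1, hmax _ m2, hαpos (b + g * q), hαpos (b + q)]
    have : 0 ≤ α (b + g * q) * (n ^ 2 * w * q ^ 2) := mul_nonneg (hαpos _).le (by positivity)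
    linarith

lemma exists_softCap_supersolution {α : ℝ → ℝ} (hα : Continuous α) (hαpos : ∀ p, 0 < α p)
    {u : ℝ → ℝ → ℝ} {S K : Set (ℝ × ℝ)} (hS : IsOpen S) (hu : RegularOn u S) (hK : IsCompact K)
    (hKS : K ⊆ S) {ε : ℝ} (hε : 0 < ε)
    (hsup : ∀ p ∈ K, α (pderivX u p.1 p.2) * pderivXX u p.1 p.2 + ε ≤ pderivT u p.1 p.2)
    (A b : ℝ) :
    ∃ n₀ : ℝ, 0 < n₀ ∧ ∀ n, n₀ ≤ n → ∀ p ∈ K,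
      α (pderivX (fun x t => A + b * x + softCap n (u x t - (A + b * x))) p.1 p.2) *
        pderivXX (fun x t => A + b * x + softCap n (u x t - (A + b * x))) p.1 p.2 ≤
      pderivT (fun x t => A + b * x + softCap n (u x t - (A + b * x))) p.1 p.2 := by
  obtain ⟨B₁, hB₁⟩ := hK.exists_bound_of_continuousOn
    ((hu.2.2.2.2.1.mono hKS).sub (continuousOn_const (c := b)))
  obtain ⟨B₂, hB₂⟩ := hK.exists_bound_of_continuousOn (hu.2.2.2.2.2.1.mono hKS)
  obtain ⟨n₀, hn₀, h⟩ := exists_softCap_ineq hα hαpos b hε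
    (lt_max_of_lt_right one_pos : 0 < max (max B₁ B₂) 1)
  refine ⟨n₀, hn₀, fun n hn p hp => ?_⟩
  obtain ⟨h1, h2, h3⟩ := (hu.softCap_pderivs hS n A b).2 p (hKS hp)
  rw [h1, h2, h3]
  refine h n hn _ _ _ _ ((hB₁ p hp).trans ((le_max_left _ _).trans (le_max_left _ _)))
    ((hB₂ p hp).trans ((le_max_right _ _).trans (le_max_left _ _))) ?_
  rw [add_sub_cancel]
  exact hsup p hp

/-- A supersolution on a finite time interval `[0, T]` bounds `psiPlus` at all times before `T`:
slowing down time and adding a multiple of the lost time extends it to all of `[0, ∞)`. -/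
lemma psiPlus_le_of_supersolution {α : ℝ → ℝ} {L : ℝ} {ψ : ℝ → ℝ} {u : ℝ → ℝ → ℝ} {T t₀ C : ℝ}
    (ht₀ : 0 ≤ t₀) (hT : t₀ < T) (hC : 0 ≤ C)
    (hnn : ∀ p ∈ Icc 0 (L / 2) ×ˢ Icc 0 T, 0 ≤ u p.1 p.2)
    (hc : ContinuousOn (fun p : ℝ × ℝ => u p.1 p.2) (Icc 0 (L / 2) ×ˢ Icc 0 T))
    (hr : RegularOn u (Ioo 0 (L / 2) ×ˢ Ioo 0 T))
    (hs : ∀ p ∈ Ioo 0 (L / 2) ×ˢ Ioo 0 T,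
      α (pderivX u p.1 p.2) * pderivXX u p.1 p.2 ≤ pderivT u p.1 p.2)
    (hub : ∀ p ∈ Ioo 0 (L / 2) ×ˢ Ioo 0 T, pderivT u p.1 p.2 ≤ C)
    (hψ : ∀ z ∈ Ioo 0 (L / 2), ψ z ≤ u z 0) {x : ℝ} (hx : x ∈ Icc 0 (L / 2)) :
    psiPlus α L ψ x t₀ ≤ u x t₀ := by
  set n : ℝ := π / 2 / (T - t₀)
  have hTt : 0 < T - t₀ := sub_pos.2 hT
  have hn : 0 < n := by positivity
  set σ : ℝ → ℝ := fun t => t₀ + softCap n (t - t₀) with hσ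
  have hσ' : ∀ t, HasDerivAt σ (gaussProfile n (t - t₀)) t := fun t =>
    ((hasDerivAt_softCap n (t - t₀)).comp_sub_const t t₀).const_add t₀
  have hσc : Continuous σ := continuous_iff_continuousAt.2 fun t => (hσ' t).continuousAt
  have hσeq : ∀ t ≤ t₀, σ t = t := fun t ht => by
    simp only [hσ]; rw [softCap_of_nonpos n (by linarith)]; ring
  have hσle : ∀ t, σ t ≤ t := fun t => by
    rcases le_total t t₀ with h | h
    · exact (hσeq t h).le
    · have := softCap_le_self n (sub_nonneg.2 h)
      simp only [hσ]; linarith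
  have hσT : ∀ t, σ t < T := fun t => by
    have h1 := softCap_lt hn (t - t₀)
    have h2 : π / 2 / n = T - t₀ := by simp only [n]; field_simp
    simp only [hσ]; linarith
  have hσ0 : ∀ t, 0 ≤ t → 0 ≤ σ t := fun t ht => by
    rcases le_total t t₀ with h | h
    · rwa [hσeq t h]
    · exact add_nonneg ht₀ (softCap_nonneg n (sub_nonneg.2 h))
  have hσpos : ∀ t, 0 < t → 0 < σ t := fun t ht => by
    rcases le_or_gt t t₀ with h | h
    · rwa [hσeq t h]
    · exact add_pos_of_nonneg_of_pos ht₀ (softCap_pos n (sub_pos.2 h))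
  set m : ℝ → ℝ → ℝ := fun z t => u z (σ t) + C * (t - σ t) with hm
  have mX : ∀ z t, pderivX m z t = pderivX u z (σ t) := fun z t => by
    simp only [pderivX, hm, deriv_add_const]
  have mXX : ∀ z t, pderivXX m z t = pderivXX u z (σ t) := fun z t => by
    simp only [pderivXX, mX]
  have hmap : ∀ p ∈ Ioo 0 (L / 2) ×ˢ Ioi (0 : ℝ), (p.1, σ p.2) ∈ Ioo 0 (L / 2) ×ˢ Ioo 0 T :=
    fun p hp => ⟨hp.1, hσpos _ hp.2, hσT _⟩
  have hmT : ∀ p ∈ Ioo 0 (L / 2) ×ˢ Ioi (0 : ℝ), HasDerivAt (fun s => m p.1 s)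
      (pderivT u p.1 (σ p.2) * gaussProfile n (p.2 - t₀) + C * (1 - gaussProfile n (p.2 - t₀)))
      p.2 := fun p hp => by
    have h1 : HasDerivAt (fun s => u p.1 s) (pderivT u p.1 (σ p.2)) (σ p.2) :=
      (hr.2.2.2.1 _ (hmap p hp)).hasDerivAt
    exact (h1.comp p.2 (hσ' p.2)).add (((hasDerivAt_id p.2).sub (hσ' p.2)).const_mul C)
  have mT := fun p hp => (hmT p hp).deriv
  have hcomp : Continuous fun p : ℝ × ℝ => (p.1, σ p.2) := by fun_prop
  have hmem : MemS α L ψ m := by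
    refine ⟨fun z t hz ht => ?_, ?_, ⟨?_, fun p hp => ?_, fun p hp => ?_,
      fun p hp => (hmT p hp).differentiableAt, ?_, ?_, ?_⟩, fun z t hz ht => ?_, fun z hz => ?_⟩
    · exact add_nonneg (hnn (z, σ t) ⟨hz, hσ0 t ht, (hσT t).le⟩)
        (mul_nonneg hC (sub_nonneg.2 (hσle t)))
    · refine ContinuousOn.add (hc.comp hcomp.continuousOn fun p hp => ?_) (by fun_prop)
      exact ⟨hp.1.1, hσ0 _ hp.1.2, (hσT _).le⟩
    · exact ContinuousOn.add (hr.1.comp hcomp.continuousOn hmap) (by fun_prop)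
    · exact (hr.2.1 _ (hmap p hp)).add_const _
    · simp only [mX]
      exact hr.2.2.1 _ (hmap p hp)
    · simp only [mX]
      exact hr.2.2.2.2.1.comp hcomp.continuousOn hmap
    · simp only [mXX]
      exact hr.2.2.2.2.2.1.comp hcomp.continuousOn hmap
    · refine ContinuousOn.congr ?_ mT
      have hg : Continuous fun p : ℝ × ℝ => gaussProfile n (p.2 - t₀) :=
        (continuous_gaussProfile n).comp (by fun_prop)
      exact ((hr.2.2.2.2.2.2.comp hcomp.continuousOn hmap).mul hg.continuousOn).add
        (continuousOn_const.mul (continuousOn_const.sub hg.continuousOn))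
    · have hp := hmap (z, t) ⟨hz, ht⟩
      have e := mT (z, t) ⟨hz, ht⟩
      change pderivT m z t = _ at e
      rw [mX, mXX, e]
      have h1 := hs _ hp
      have h2 := hub _ hp
      have h3 := mul_nonneg (sub_nonneg.2 h2) (sub_nonneg.2 (gaussProfile_le_one n (t - t₀)))
      simp only at h1 h3 ⊢
      linarith
    · have := hψ z hz
      simpa only [hm, hσeq 0 ht₀, sub_self, mul_zero, add_zero] using this
  have hval : m x t₀ = u x t₀ := by
    simp only [hm, hσeq t₀ le_rfl, sub_self, mul_zero, add_zero]
  rw [← hval]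
  refine csInf_le ⟨0, ?_⟩ ⟨m, hmem, rfl⟩
  rintro y ⟨φ, hφ, rfl⟩
  exact hφ.1 x t₀ hx ht₀

/-- If `v` has no interior minimum in the parabolic sense, then a point where `v < 0` can be
joined to the parabolic boundary by a continuous curve, a graph over time, along which `v < 0`. -/
lemma exists_curve_to_parabolicBoundary {a t₀ z : ℝ} {v : ℝ → ℝ → ℝ}
    (hv : ContinuousOn (fun p : ℝ × ℝ => v p.1 p.2) (Icc 0 a ×ˢ Icc 0 t₀))
    (hmin : ∀ w ∈ Ioo 0 a, ∀ s ∈ Ioc 0 t₀, (∀ᶠ y in nhds w, v w s ≤ v y s) →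
      (∀ᶠ r in nhdsWithin s (Iio s), v w s ≤ v w r) → False)
    (hz : z ∈ Icc 0 a) (ht₀ : 0 ≤ t₀) (hneg : v z t₀ < 0) :
    ∃ γ : ℝ → ℝ, ∃ s₀ ∈ Icc 0 t₀, Continuous γ ∧ γ t₀ = z ∧
      (∀ t ∈ Icc s₀ t₀, γ t ∈ Icc 0 a ∧ v (γ t) t < 0) ∧ (s₀ = 0 ∨ γ s₀ = 0 ∨ γ s₀ = a) := by
  set R : Set (ℝ × ℝ) := Icc 0 a ×ˢ Icc 0 t₀ with hR
  have hRc : Convex ℝ R := (convex_Icc 0 a).prod (convex_Icc 0 t₀)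
  let reach : Set (ℝ × ℝ) := {p | p.2 ∈ Icc 0 t₀ ∧ ∃ γ : ℝ → ℝ, Continuous γ ∧ γ t₀ = z ∧
    γ p.2 = p.1 ∧ ∀ t ∈ Icc p.2 t₀, γ t ∈ Icc 0 a ∧ v (γ t) t < 0}
  have hreachR : reach ⊆ R := by
    rintro p ⟨h1, γ, -, -, h2, h3⟩
    exact ⟨h2 ▸ (h3 p.2 ⟨le_rfl, h1.2⟩).1, h1⟩
  have hstart : (z, t₀) ∈ reach := by
    refine ⟨⟨ht₀, le_rfl⟩, fun _ => z, continuous_const, rfl, rfl, fun t ht => ⟨hz, ?_⟩⟩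
    rwa [le_antisymm ht.2 ht.1]
  have hclR : closure reach ⊆ R :=
    closure_minimal hreachR (isClosed_Icc.prod isClosed_Icc)
  have hcomp : IsCompact (closure reach) :=
    (isCompact_Icc.prod isCompact_Icc).of_isClosed_subset isClosed_closure hclR
  obtain ⟨⟨w, s⟩, hwsC, hwsmin⟩ :=
    hcomp.exists_isMinOn ⟨_, subset_closure hstart⟩ (hv.mono hclR)
  have hmin' : ∀ q ∈ closure reach, v w s ≤ v q.1 q.2 := fun q hq => hwsmin hq
  have hws0 : v w s < 0 := (hmin' _ (subset_closure hstart)).trans_lt hneg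
  have hwsR : (w, s) ∈ R := hclR hwsC
  obtain ⟨r, hr, hball⟩ : ∃ r > 0, ∀ q ∈ Metric.ball (w, s) r ∩ R, v q.1 q.2 < 0 := by
    have := (hv (w, s) hwsR).eventually_lt_const hws0
    exact Metric.mem_nhdsWithin_iff.1 this
  -- inside the ball, everything strictly below a reached point is reached
  have hext : ∀ p ∈ reach, p ∈ Metric.ball (w, s) r → ∀ q ∈ R, q ∈ Metric.ball (w, s) r →
      q.2 < p.2 → q ∈ reach := by
    rintro p ⟨hp1, γ, hγ, hγt, hγp, hγv⟩ hpb q hqR hqb hlt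
    have hpR : p ∈ R := hreachR ⟨hp1, γ, hγ, hγt, hγp, hγv⟩
    have hd : 0 < p.2 - q.2 := sub_pos.2 hlt
    let lin : ℝ → ℝ := fun t => p.1 + (p.2 - t) / (p.2 - q.2) * (q.1 - p.1)
    have hlin : Continuous lin := by fun_prop
    refine ⟨hqR.2, fun t => if t ≤ p.2 then lin t else γ t, ?_, ?_, ?_, ?_⟩
    · refine Continuous.if_le hlin hγ continuous_id continuous_const fun t ht => ?_
      simp [lin, ht, hγp]
    · by_cases h : t₀ ≤ p.2
      · have : t₀ = p.2 := le_antisymm h hp1.2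
        simp only [if_pos h]
        rw [← hγt, this, hγp]
        simp [lin]
      · simp only [if_neg h, hγt]
    · simp only [if_pos hlt.le, lin]
      rw [div_self hd.ne']; ring
    · intro t ht
      by_cases h : t ≤ p.2
      · simp only [if_pos h]
        set c : ℝ := (p.2 - t) / (p.2 - q.2) with hc
        have hc0 : 0 ≤ c := div_nonneg (sub_nonneg.2 h) hd.le
        have hc1 : c ≤ 1 := (div_le_one hd).2 (by linarith [ht.1])
        have hpt : (lin t, t) = (1 - c) • p + c • q := by
          ext
          · simp only [lin, Prod.fst_add, Prod.smul_fst, smul_eq_mul, ← hc]; ring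
          · have : c * (p.2 - q.2) = p.2 - t := div_mul_cancel₀ _ hd.ne'
            simp only [Prod.snd_add, Prod.smul_snd, smul_eq_mul]; linarith
        have hmR : (lin t, t) ∈ R :=
          hpt ▸ hRc hpR hqR (by linarith) hc0 (by ring)
        have hmb : (lin t, t) ∈ Metric.ball (w, s) r :=
          hpt ▸ convex_ball (w, s) r hpb hqb (by linarith) hc0 (by ring)
        exact ⟨hmR.1, hball _ ⟨hmb, hmR⟩⟩
      · simp only [if_neg h]
        exact hγv t ⟨(not_le.1 h).le, ht.2⟩
  have hnear : ∀ δ > 0, ∃ q ∈ reach, dist q (w, s) < δ := fun δ hδ => by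
    obtain ⟨q, hq, hd⟩ := Metric.mem_closure_iff.1 hwsC δ hδ
    exact ⟨q, hq, by rwa [dist_comm]⟩
  have hconc : ∀ q ∈ reach, (q.2 = 0 ∨ q.1 = 0 ∨ q.1 = a) → ∃ γ : ℝ → ℝ, ∃ s₀ ∈ Icc 0 t₀,
      Continuous γ ∧ γ t₀ = z ∧ (∀ t ∈ Icc s₀ t₀, γ t ∈ Icc 0 a ∧ v (γ t) t < 0) ∧
      (s₀ = 0 ∨ γ s₀ = 0 ∨ γ s₀ = a) := by
    rintro q ⟨h1, γ, h2, h3, h4, h5⟩ hq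
    exact ⟨γ, q.2, h1, h2, h3, h5, by rwa [h4]⟩
  rcases hwsR.2.1.eq_or_lt with hs0 | hs0
  · obtain ⟨q, hq, hqd⟩ := hnear r hr
    rcases (hreachR hq).2.1.eq_or_lt with hq0 | hq0
    · exact hconc q hq (Or.inl hq0.symm)
    · refine hconc (q.1, 0) (hext q hq hqd _ ⟨(hreachR hq).1, le_rfl, ht₀⟩ ?_ hq0) (Or.inl rfl)
      rw [Prod.dist_eq] at hqd
      rw [Metric.mem_ball, Prod.dist_eq]
      refine max_lt ((le_max_left _ _).trans_lt hqd) ?_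
      have hs0' : s = 0 := hs0.symm
      simpa [hs0'] using hr
  -- points straight below `(w, s)` and close to it are reached
  have hbelow : ∀ r' ∈ Ico 0 s, s - r < r' → ∀ y ∈ Icc 0 a, dist y w < r → (y, r') ∈ reach := by
    intro r' hr' hsr y hy hyw
    obtain ⟨q, hq, hqd⟩ := hnear (min r (s - r')) (lt_min hr (sub_pos.2 hr'.2))
    refine hext q hq (hqd.trans_le (min_le_left _ _)) _ ⟨hy, hr'.1, hr'.2.le.trans hwsR.2.2⟩ ?_ ?_
    · rw [Metric.mem_ball, Prod.dist_eq]
      refine max_lt hyw ?_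
      rw [Real.dist_eq, abs_lt]
      constructor <;> simp only <;> linarith [hr'.2]
    · have h1 : dist q.2 s < s - r' := by
        rw [Prod.dist_eq] at hqd
        exact ((le_max_right _ _).trans_lt hqd).trans_le (min_le_right _ _)
      rw [Real.dist_eq, abs_lt] at h1
      linarith [h1.1]
  by_cases hw : w = 0 ∨ w = a
  · have h1 : max 0 (s - r) < s := max_lt hs0 (by linarith)
    obtain ⟨r', h2, h3⟩ := exists_between h1
    rw [max_lt_iff] at h2
    exact hconc (w, r') (hbelow r' ⟨h2.1.le, h3⟩ h2.2 w hwsR.1 (by rwa [dist_self])) (Or.inr hw)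
  · rw [not_or] at hw
    have hwI : w ∈ Ioo 0 a :=
      ⟨lt_of_le_of_ne hwsR.1.1 (Ne.symm hw.1), lt_of_le_of_ne hwsR.1.2 hw.2⟩
    have hev : ∀ᶠ r' in nhdsWithin s (Iio s), r' ∈ Ico 0 s ∧ s - r < r' := by
      filter_upwards [self_mem_nhdsWithin,
        mem_nhdsWithin_of_mem_nhds (Ioi_mem_nhds (max_lt hs0 (by linarith : s - r < s)))]
        with r' h1 h2
      have := max_lt_iff.1 (mem_Ioi.1 h2)
      exact ⟨⟨this.1.le, h1⟩, this.2⟩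
    refine (hmin w hwI s ⟨hs0, hwsR.2.2⟩ ?_ ?_).elim
    · filter_upwards [Metric.ball_mem_nhds w hr, Ioo_mem_nhds hwI.1 hwI.2] with y hy hyI
      refine hmin' (y, s) (mem_closure_of_tendsto (f := fun r' => (y, r'))
        (b := nhdsWithin s (Iio s)) ?_ ?_)
      · exact (Continuous.prodMk continuous_const continuous_id).continuousWithinAt
      · exact hev.mono fun r' h => hbelow r' h.1 h.2 y (Ioo_subset_Icc_self hyI) hy
    · filter_upwards [hev] with r' h
      exact hmin' (w, r') (subset_closure
        (hbelow r' h.1 h.2 w hwsR.1 (by rwa [dist_self])))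

open Classical in
/-- Replacing a strict supersolution `u` by (a smoothing of) `min u ℓ`, with `ℓ = A + b x`, on a set
`P` whose frontier lies in `{u < ℓ}` yields an admissible supersolution. -/
lemma psiPlus_le_affine {α : ℝ → ℝ} (hα : Continuous α) (hαpos : ∀ p, 0 < α p) {L : ℝ}
    {ψ : ℝ → ℝ} {u : ℝ → ℝ → ℝ} {Ω : Set (ℝ × ℝ)} (hΩ : IsOpen Ω) (hu : RegularOn u Ω)
    {T t₀ ε : ℝ} (ht₀ : 0 ≤ t₀) (hT : t₀ < T) (hRΩ : Icc 0 (L / 2) ×ˢ Icc 0 T ⊆ Ω)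
    (hnn : ∀ p ∈ Icc 0 (L / 2) ×ˢ Icc 0 T, 0 ≤ u p.1 p.2) (hε : 0 < ε)
    (hsup : ∀ p ∈ Icc 0 (L / 2) ×ˢ Icc 0 T,
      α (pderivX u p.1 p.2) * pderivXX u p.1 p.2 + ε ≤ pderivT u p.1 p.2)
    (hψ : ∀ z ∈ Ioo 0 (L / 2), ψ z ≤ u z 0) (A b : ℝ) (P : Set (ℝ × ℝ))
    (hP : ∀ p ∈ Icc 0 (L / 2) ×ˢ Icc 0 T, u p.1 p.2 < A + b * p.1 ∨
      P ∈ nhdsWithin p (Icc 0 (L / 2) ×ˢ Icc 0 T) ∨ Pᶜ ∈ nhdsWithin p (Icc 0 (L / 2) ×ˢ Icc 0 T))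
    (hPnn : ∀ p ∈ Icc 0 (L / 2) ×ˢ Icc 0 T, p ∈ P → 0 ≤ A + b * p.1)
    (hPψ : ∀ z ∈ Ioo 0 (L / 2), (z, (0 : ℝ)) ∈ P → ψ z ≤ A + b * z) {x : ℝ}
    (hx : x ∈ Icc 0 (L / 2)) (hxP : (x, t₀) ∈ P) :
    psiPlus α L ψ x t₀ ≤ A + b * x := by
  set R : Set (ℝ × ℝ) := Icc 0 (L / 2) ×ˢ Icc 0 T with hR
  set R' : Set (ℝ × ℝ) := Ioo 0 (L / 2) ×ˢ Ioo 0 T with hR'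
  have hRcomp : IsCompact R := isCompact_Icc.prod isCompact_Icc
  have hR'open : IsOpen R' := isOpen_Ioo.prod isOpen_Ioo
  have hR'R : R' ⊆ R := prod_mono Ioo_subset_Icc_self Ioo_subset_Icc_self
  obtain ⟨B, hB⟩ := hRcomp.exists_bound_of_continuousOn (hu.2.2.2.2.2.2.mono hRΩ)
  obtain ⟨n₀, hn₀, hmod⟩ := exists_softCap_supersolution hα hαpos hΩ hu hRcomp hRΩ hε hsup A b
  suffices h : ∀ n, n₀ ≤ n → psiPlus α L ψ x t₀ ≤ A + b * x + π / 2 / n by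
    have hlim : Tendsto (fun n : ℝ => A + b * x + π / 2 / n) atTop (nhds (A + b * x + 0)) :=
      tendsto_const_nhds.add (tendsto_const_nhds.div_atTop tendsto_id)
    rw [add_zero] at hlim
    exact ge_of_tendsto hlim (eventually_atTop.2 ⟨n₀, h⟩)
  intro n hn
  have hnpos : 0 < n := hn₀.trans_le hn
  set m : ℝ → ℝ → ℝ := fun x t => A + b * x + softCap n (u x t - (A + b * x)) with hm
  obtain ⟨hmreg, hmder⟩ := hu.softCap_pderivs hΩ n A b
  have hmeq : ∀ z t, u z t ≤ A + b * z → m z t = u z t := fun z t h => by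
    simp only [hm]; rw [softCap_of_nonpos n (by linarith)]; ring
  have hmge : ∀ z t, A + b * z ≤ u z t → A + b * z ≤ m z t := fun z t h => by
    have := softCap_nonneg n (sub_nonneg.2 h)
    simp only [hm]; linarith
  set w : ℝ → ℝ → ℝ := fun z t => if (z, t) ∈ P then m z t else u z t with hw
  have hloc : ∀ p ∈ R, (∀ᶠ q in nhdsWithin p R, w q.1 q.2 = m q.1 q.2) ∨
      (∀ᶠ q in nhdsWithin p R, w q.1 q.2 = u q.1 q.2) := by
    intro p hp
    rcases hP p hp with h | h | h
    · right
      have hc : ContinuousWithinAt (fun q : ℝ × ℝ => u q.1 q.2 - (A + b * q.1)) R p :=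
        ((hu.1.mono hRΩ).sub (by fun_prop)) p hp
      filter_upwards [hc.eventually_lt_const (sub_neg.2 h)] with q hq
      simp only [hw, hmeq q.1 q.2 (sub_neg.1 hq).le, ite_self]
    · left
      filter_upwards [h] with q hq
      exact if_pos hq
    · right
      filter_upwards [h] with q hq
      exact if_neg hq
  have hloc' : ∀ p ∈ R', (∀ᶠ q in nhds p, w q.1 q.2 = m q.1 q.2) ∨
      (∀ᶠ q in nhds p, w q.1 q.2 = u q.1 q.2) := by
    intro p hp
    have := hloc p (hR'R hp)
    rwa [nhdsWithin_eq_nhds.2 (mem_of_superset (hR'open.mem_nhds hp) hR'R)] at this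
  have hcases : ∀ z t, w z t = u z t ∨ ((z, t) ∈ P ∧ A + b * z ≤ w z t) := by
    intro z t
    by_cases hzP : (z, t) ∈ P
    · simp only [hw, if_pos hzP]
      rcases le_total (u z t) (A + b * z) with h | h
      · exact Or.inl (hmeq z t h)
      · exact Or.inr ⟨hzP, hmge z t h⟩
    · exact Or.inl (if_neg hzP)
  have hwx : w x t₀ ≤ A + b * x + π / 2 / n := by
    simp only [hw, if_pos hxP, hm]
    linarith [softCap_lt hnpos (u x t₀ - (A + b * x))]
  refine (psiPlus_le_of_supersolution (T := T) (C := |B|) ht₀ hT (abs_nonneg B) ?_ ?_ ?_ ?_ ?_ ?_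
    hx).trans hwx
  · intro p hp
    rcases hcases p.1 p.2 with h | ⟨h1, h2⟩
    · rw [h]; exact hnn p hp
    · exact (hPnn p hp h1).trans h2
  · intro p hp
    rcases hloc p hp with h | h
    · exact ((hmreg.1.mono hRΩ) p hp).congr_of_eventuallyEq h (h.self_of_nhdsWithin hp)
    · exact ((hu.1.mono hRΩ) p hp).congr_of_eventuallyEq h (h.self_of_nhdsWithin hp)
  · refine RegularOn.of_locally_eq hR'open fun p hp => ?_
    rcases hloc' p hp with h | h
    · exact ⟨m, hmreg.mono (hR'R.trans hRΩ), h⟩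
    · exact ⟨u, hu.mono (hR'R.trans hRΩ), h⟩
  · intro p hp
    rcases hloc' p hp with h | h <;>
      rw [(pderivX_congr h).self_of_nhds, (pderivXX_congr h).self_of_nhds,
        (pderivT_congr h).self_of_nhds]
    · exact hmod n hn p (hR'R hp)
    · linarith [hsup p (hR'R hp)]
  · intro p hp
    have hb : |pderivT u p.1 p.2| ≤ |B| := (hB p (hR'R hp)).trans (le_abs_self B)
    rcases hloc' p hp with h | h <;> rw [(pderivT_congr h).self_of_nhds]
    · rw [(hmder p (hRΩ (hR'R hp))).2.2]
      refine (le_abs_self _).trans ?_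
      rw [abs_mul, abs_of_pos (gaussProfile_pos _ _)]
      exact (mul_le_of_le_one_left (abs_nonneg _) (gaussProfile_le_one _ _)).trans hb
    · exact (le_abs_self _).trans hb
  · intro z hz
    rcases hcases z 0 with h | ⟨h1, h2⟩
    · rw [h]; exact hψ z hz
    · exact (hPψ z hz h1).trans h2

lemma deriv_deriv_nonneg_of_isLocalMin {f : ℝ → ℝ} {x : ℝ} (h : IsLocalMin f x)
    (hf : DifferentiableAt ℝ f x) : 0 ≤ deriv (deriv f) x := by
  by_contra! hneg
  have hmax := isLocalMax_of_deriv_deriv_neg hneg h.deriv_eq_zero hf.continuousAt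
  have hconst : f =ᶠ[nhds x] fun _ => f x := by
    filter_upwards [h, hmax] with y h1 h2 using le_antisymm h2 h1
  have h2 : deriv f =ᶠ[nhds x] fun _ => 0 := by
    simpa using hconst.deriv
  rw [h2.deriv_eq] at hneg
  simp at hneg

lemma HasDerivAt.nonpos_of_le_left {f : ℝ → ℝ} {f' x : ℝ} (hf : HasDerivAt f f' x)
    (h : ∀ᶠ y in nhdsWithin x (Iio x), f x ≤ f y) : f' ≤ 0 := by
  have h1 : Tendsto (slope f x) (nhdsWithin x (Iio x)) (nhds f') :=
    (hasDerivWithinAt_iff_tendsto_slope' (by simp)).1 hf.hasDerivWithinAt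
  refine le_of_tendsto h1 ?_
  filter_upwards [h, self_mem_nhdsWithin] with y hy hyx
  rw [slope_def_field]
  exact div_nonpos_of_nonneg_of_nonpos (sub_nonneg.2 hy) (sub_nonpos.2 (mem_Iio.1 hyx).le)

/-- A strict supersolution minus an affine function has no interior minimum. -/
lemma no_interior_min_of_strict_supersolution {α : ℝ → ℝ} (hαpos : ∀ p, 0 < α p)
    {u : ℝ → ℝ → ℝ} {w s A b ε : ℝ}
    (hT : DifferentiableAt ℝ (fun r => u w r) s) (hε : 0 < ε)
    (hX : ∀ᶠ y in nhds w, DifferentiableAt ℝ (fun y => u y s) y)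
    (hsup : α (pderivX u w s) * pderivXX u w s + ε ≤ pderivT u w s)
    (h1 : ∀ᶠ y in nhds w, u w s - (A + b * w) ≤ u y s - (A + b * y))
    (h2 : ∀ᶠ r in nhdsWithin s (Iio s), u w s - (A + b * w) ≤ u w r - (A + b * w)) : False := by
  have hT' : pderivT u w s ≤ 0 :=
    hT.hasDerivAt.nonpos_of_le_left (h2.mono fun r hr => by linarith)
  have haff : ∀ y, HasDerivAt (fun y : ℝ => A + b * y) b y := fun y => by
    simpa using ((hasDerivAt_id y).const_mul b).const_add A
  have hd := deriv_deriv_nonneg_of_isLocalMin (f := fun y => u y s - (A + b * y)) h1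
    (hX.self_of_nhds.sub (haff w).differentiableAt)
  have he : deriv (deriv fun y => u y s - (A + b * y)) w = pderivXX u w s := by
    have h3 : (deriv fun y => u y s - (A + b * y)) =ᶠ[nhds w] fun y => pderivX u y s - b := by
      filter_upwards [hX] with y hy
      exact (hy.hasDerivAt.sub (haff y)).deriv
    rw [h3.deriv_eq, deriv_sub_const]
    rfl
  rw [he] at hd
  have := mul_nonneg (hαpos (pderivX u w s)).le hd
  linarith

lemma mem_nhdsWithin_of_curve {γ : ℝ → ℝ} (hγ : Continuous γ) {e : ℝ} (he : e ≠ 0)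
    {R : Set (ℝ × ℝ)} {Q : ℝ × ℝ → Prop}
    (h : ∀ p ∈ R, p.1 = γ p.2 → Q p ∨ ∀ᶠ q in nhdsWithin p R, e * (γ q.2 - q.1) ≤ 0) :
    ∀ p ∈ R, Q p ∨ {q : ℝ × ℝ | 0 < e * (γ q.2 - q.1)} ∈ nhdsWithin p R ∨
      {q : ℝ × ℝ | 0 < e * (γ q.2 - q.1)}ᶜ ∈ nhdsWithin p R := by
  intro p hp
  have hc : Continuous fun q : ℝ × ℝ => e * (γ q.2 - q.1) := by fun_prop
  rcases lt_trichotomy (e * (γ p.2 - p.1)) 0 with h0 | h0 | h0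
  · right; right
    filter_upwards [mem_nhdsWithin_of_mem_nhds (hc.continuousAt.eventually_lt_const h0)] with q hq
    exact not_lt.2 (le_of_lt hq)
  · have : p.1 = γ p.2 := by
      rcases mul_eq_zero.1 h0 with h1 | h1
      · exact (he h1).elim
      · linarith
    rcases h p hp this with h1 | h1
    · exact Or.inl h1
    · right; right
      filter_upwards [h1] with q hq
      exact not_lt.2 hq
  · right; left
    exact mem_nhdsWithin_of_mem_nhds (hc.continuousAt.eventually_const_lt h0)

lemma affine_nonneg_of_nonneg_endpoints {A b x y w : ℝ} (hx : 0 ≤ A + b * x) (hy : 0 ≤ A + b * y)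
    (h1 : x ≤ w) (h2 : w ≤ y) : 0 ≤ A + b * w := by
  rcases le_total 0 b with hb | hb
  · linarith [mul_le_mul_of_nonneg_left h1 hb]
  · linarith [mul_le_mul_of_nonpos_left h2 hb]

/-- If a strict supersolution lies below the affine function `ℓ = A + b x` at an interior point
`z` then `psiPlus` cannot exceed `ℓ` on both sides of `z`. -/
lemma psiPlus_le_affine_or {α : ℝ → ℝ} (hα : Continuous α) (hαpos : ∀ p, 0 < α p) {L : ℝ}
    (hL : 0 < L) {ψ : ℝ → ℝ} (hψconc : ConcaveOn ℝ (Ioo 0 (L / 2)) ψ)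
    (hψpos : ∀ z ∈ Ioo (0 : ℝ) (L / 2), 0 < ψ z)
    {u : ℝ → ℝ → ℝ} {Ω : Set (ℝ × ℝ)} (hΩ : IsOpen Ω) (hu : RegularOn u Ω)
    {T t₀ ε : ℝ} (ht₀ : 0 ≤ t₀) (hT : t₀ < T) (hRΩ : Icc 0 (L / 2) ×ˢ Icc 0 T ⊆ Ω)
    (hnn : ∀ p ∈ Icc 0 (L / 2) ×ˢ Icc 0 T, 0 ≤ u p.1 p.2) (hε : 0 < ε)
    (hsup : ∀ p ∈ Icc 0 (L / 2) ×ˢ Icc 0 T,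
      α (pderivX u p.1 p.2) * pderivXX u p.1 p.2 + ε ≤ pderivT u p.1 p.2)
    (hψ : ∀ z ∈ Ioo 0 (L / 2), ψ z ≤ u z 0) (A b : ℝ) {x y z : ℝ} (hx : x ∈ Icc 0 (L / 2))
    (hy : y ∈ Icc 0 (L / 2)) (hxz : x < z) (hzy : z < y)
    (hz : ∀ t ∈ Icc t₀ T, u z t < A + b * z) :
    psiPlus α L ψ x t₀ ≤ A + b * x ∨ psiPlus α L ψ y t₀ ≤ A + b * y := by
  set R : Set (ℝ × ℝ) := Icc 0 (L / 2) ×ˢ Icc 0 T with hR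
  have ha : 0 < L / 2 := by linarith
  have hzI : z ∈ Icc 0 (L / 2) := ⟨hx.1.trans hxz.le, hzy.le.trans hy.2⟩
  have hXev : ∀ w s, (w, s) ∈ Ω → ∀ᶠ y in nhds w, DifferentiableAt ℝ (fun y => u y s) y := by
    intro w s hws
    have hc : Tendsto (fun y : ℝ => (y, s)) (nhds w) (nhds (w, s)) :=
      (Continuous.prodMk continuous_id continuous_const).tendsto' _ _ rfl
    exact (hc.eventually (hΩ.mem_nhds hws)).mono fun y hy => hu.2.1 _ hy
  have hsub : Icc 0 (L / 2) ×ˢ Icc 0 t₀ ⊆ R := prod_mono_right (Icc_subset_Icc_right hT.le)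
  obtain ⟨γ, s₀, hs₀, hγc, hγt, hγ, hend⟩ := exists_curve_to_parabolicBoundary (a := L / 2)
    (t₀ := t₀) (z := z) (v := fun w t => u w t - (A + b * w))
    (((hu.1.mono hRΩ).mono hsub).sub (by fun_prop))
    (fun w hw s hs h1 h2 => by
      have hp : (w, s) ∈ R := hsub ⟨Ioo_subset_Icc_self hw, Ioc_subset_Icc_self hs⟩
      exact no_interior_min_of_strict_supersolution hαpos (hu.2.2.2.1 _ (hRΩ hp)) hε
        (hXev w s (hRΩ hp)) (hsup _ hp) h1 h2)
    hzI ht₀ (sub_neg.2 (hz t₀ ⟨le_rfl, hT.le⟩))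
  -- extend the curve by constants on both sides
  set β : ℝ → ℝ := fun t => γ (max s₀ (min t t₀)) with hβ
  have hβc : Continuous β := by fun_prop
  have hβt : β t₀ = z := by simp only [hβ, min_self, max_eq_right hs₀.2, hγt]
  have hβlow : ∀ t ≤ s₀, β t = γ s₀ := fun t ht => by
    simp only [hβ, min_eq_left (ht.trans hs₀.2), max_eq_left ht]
  have hβI : ∀ t, β t ∈ Icc 0 (L / 2) := fun t =>
    (hγ _ ⟨le_max_left _ _, max_le hs₀.2 (min_le_right _ _)⟩).1
  have hβneg : ∀ t ∈ Icc s₀ T, u (β t) t < A + b * β t := by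
    intro t ht
    rcases le_total t t₀ with h | h
    · have e : β t = γ t := by simp only [hβ, min_eq_left h, max_eq_right ht.1]
      rw [e]
      exact sub_neg.1 (hγ t ⟨ht.1, h⟩).2
    · have e : β t = z := by simp only [hβ, min_eq_right h, max_eq_right hs₀.2, hγt]
      rw [e]
      exact hz t ⟨h, ht.2⟩
  have hβpos : ∀ t ∈ Icc s₀ T, 0 ≤ A + b * β t := fun t ht =>
    (hnn (β t, t) ⟨hβI t, hs₀.1.trans ht.1, ht.2⟩).trans (hβneg t ht).le
  have hearly : ∀ (e v₀ : ℝ), (s₀ = 0 ∨ γ s₀ = v₀) → (∀ w ∈ Icc 0 (L / 2), e * (v₀ - w) ≤ 0) →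
      ∀ p ∈ R, p.1 = β p.2 → u p.1 p.2 < A + b * p.1 ∨
        ∀ᶠ q in nhdsWithin p R, e * (β q.2 - q.1) ≤ 0 := by
    intro e v₀ hv₀ hle p hp hpβ
    rcases le_or_gt s₀ p.2 with h | h
    · left
      rw [hpβ]
      exact hβneg _ ⟨h, hp.2.2⟩
    · right
      have hγs : γ s₀ = v₀ := hv₀.resolve_left (hp.2.1.trans_lt h).ne'
      filter_upwards [self_mem_nhdsWithin, mem_nhdsWithin_of_mem_nhds
        (continuous_snd.continuousAt.eventually_lt_const h)] with q hq hqs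
      rw [hβlow _ (le_of_lt hqs), hγs]
      exact hle _ hq.1
  have hleft : (s₀ = 0 ∨ γ s₀ = 0) → 0 ≤ A →
      (∀ w ∈ Ioo 0 (L / 2), w < γ s₀ → ψ w ≤ A + b * w) →
      psiPlus α L ψ x t₀ ≤ A + b * x := by
    intro h0 hA hw
    refine psiPlus_le_affine hα hαpos hΩ hu ht₀ hT hRΩ hnn hε hsup hψ A b
      {q | 0 < 1 * (β q.2 - q.1)} (mem_nhdsWithin_of_curve hβc one_ne_zero
      (hearly 1 0 h0 fun w hw => by linarith [hw.1])) (fun p hp hpP => ?_)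
      (fun w hwI hwP => ?_) hx ?_
    · have hlt : p.1 < β p.2 := by simpa using hpP
      rcases le_or_gt s₀ p.2 with h | h
      · exact affine_nonneg_of_nonneg_endpoints (x := 0) (by linarith) (hβpos _ ⟨h, hp.2.2⟩)
          hp.1.1 hlt.le
      · rw [hβlow _ h.le, h0.resolve_left (hp.2.1.trans_lt h).ne'] at hlt
        exact absurd hp.1.1 (not_le.2 hlt)
    · refine hw w hwI ?_
      rw [← hβlow 0 hs₀.1]
      simpa using hwP
    · simpa [hβt] using hxz
  have hright : (s₀ = 0 ∨ γ s₀ = L / 2) → 0 ≤ A + b * (L / 2) →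
      (∀ w ∈ Ioo 0 (L / 2), γ s₀ < w → ψ w ≤ A + b * w) →
      psiPlus α L ψ y t₀ ≤ A + b * y := by
    intro h0 hA hw
    refine psiPlus_le_affine hα hαpos hΩ hu ht₀ hT hRΩ hnn hε hsup hψ A b
      {q | 0 < (-1) * (β q.2 - q.1)} (mem_nhdsWithin_of_curve hβc (by norm_num)
      (hearly (-1) (L / 2) h0 fun w hw => by linarith [hw.2])) (fun p hp hpP => ?_)
      (fun w hwI hwP => ?_) hy ?_
    · have hlt : β p.2 < p.1 := by simpa using hpP
      rcases le_or_gt s₀ p.2 with h | h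
      · exact affine_nonneg_of_nonneg_endpoints (hβpos _ ⟨h, hp.2.2⟩) hA hlt.le hp.1.2
      · rw [hβlow _ h.le, h0.resolve_left (hp.2.1.trans_lt h).ne'] at hlt
        exact absurd hp.1.2 (not_le.2 hlt)
    · refine hw w hwI ?_
      rw [← hβlow 0 hs₀.1]
      simpa using hwP
    · simpa [hβt] using hzy
  have hsT : s₀ ∈ Icc s₀ T := ⟨le_rfl, hs₀.2.trans hT.le⟩
  have hpos₀ := hβpos s₀ hsT
  have hneg₀ := hβneg s₀ hsT
  have hI₀ := hβI s₀
  rw [hβlow s₀ le_rfl] at hpos₀ hneg₀ hI₀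
  by_cases h0 : γ s₀ = 0
  · left
    refine hleft (Or.inr h0) (by simpa [h0] using hpos₀) fun w hw hlt => ?_
    rw [h0] at hlt
    exact absurd hw.1 hlt.not_gt
  by_cases h1 : γ s₀ = L / 2
  · right
    refine hright (Or.inr h1) (by simpa [h1] using hpos₀) fun w hw hlt => ?_
    rw [h1] at hlt
    exact absurd hw.2 hlt.not_gt
  have hs0 : s₀ = 0 := by tauto
  have hpI : γ s₀ ∈ Ioo 0 (L / 2) :=
    ⟨lt_of_le_of_ne hI₀.1 (Ne.symm h0), lt_of_le_of_ne hI₀.2 h1⟩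
  set p := γ s₀
  have hψp : ψ p < A + b * p := (hψ p hpI).trans_lt (by simpa [hs0] using hneg₀)
  -- concavity: between two points where `ψ ≥ ℓ` also `ψ ≥ ℓ`
  have hbetween : ∀ q ∈ Ioo 0 (L / 2), ∀ r ∈ Ioo 0 (L / 2), A + b * q ≤ ψ q → A + b * r ≤ ψ r →
      q < p → p < r → False := by
    intro q hq r hr hψq hψr hqp hpr
    have hc := hψconc.sub (g := fun w => A + b * w)
      ⟨convex_Ioo _ _, fun x _ y _ c d _ _ hcd => by
        simp only [smul_eq_mul]
        linear_combination -A * hcd⟩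
    have := hc.min_le_of_mem_Icc hq hr ⟨hqp.le, hpr.le⟩
    simp only [Pi.sub_apply] at this
    rcases min_le_iff.1 this with h | h <;> linarith
  by_cases hright' : ∃ q ∈ Ioo 0 (L / 2), A + b * q ≤ ψ q ∧ q < p
  · obtain ⟨q, hq, hψq, hqp⟩ := hright'
    have hw : ∀ w ∈ Ioo 0 (L / 2), p < w → ψ w < A + b * w := fun w hw hpw => by
      by_contra! h
      exact hbetween q hq w hw hψq h hqp hpw
    right
    refine hright (Or.inl hs0) ?_ fun w hwI hpw => (hw w hwI hpw).le
    have hlim : Tendsto (fun w => A + b * w) (nhdsWithin (L / 2) (Iio (L / 2)))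
        (nhds (A + b * (L / 2))) :=
      (Continuous.tendsto (by fun_prop) _).mono_left nhdsWithin_le_nhds
    refine ge_of_tendsto hlim ?_
    filter_upwards [Ioo_mem_nhdsLT hpI.2] with w hwI
    have hwI' : w ∈ Ioo 0 (L / 2) := ⟨hpI.1.trans hwI.1, hwI.2⟩
    exact ((hψpos w hwI').trans (hw w hwI' hwI.1)).le
  · push Not at hright'
    have hw : ∀ w ∈ Ioo 0 (L / 2), w < p → ψ w < A + b * w := fun w hw hwp => by
      by_contra! h
      exact absurd hwp (not_lt.2 (hright' w hw h))
    left
    refine hleft (Or.inl hs0) ?_ fun w hwI hwp => (hw w hwI hwp).le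
    have hlim : Tendsto (fun w => A + b * w) (nhdsWithin 0 (Ioi 0)) (nhds (A + b * 0)) :=
      (Continuous.tendsto (by fun_prop) _).mono_left nhdsWithin_le_nhds
    rw [mul_zero, add_zero] at hlim
    refine ge_of_tendsto hlim ?_
    filter_upwards [Ioo_mem_nhdsGT hpI.1] with w hwI
    have hwI' : w ∈ Ioo 0 (L / 2) := ⟨hwI.1, hwI.2.trans hpI.2⟩
    exact ((hψpos w hwI').trans (hw w hwI' hwI.2)).le

/-- The effect of parabolic rescaling and of adding a linear function of time. -/
lemma RegularOn.rescale {u : ℝ → ℝ → ℝ} {S : Set (ℝ × ℝ)} (hu : RegularOn u S) {d μ η ε : ℝ}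
    (hμ : μ ≠ 0) :
    RegularOn (fun x t => u (d + μ * x) (η + μ ^ 2 * t) / μ + ε * t)
      ((fun p : ℝ × ℝ => (d + μ * p.1, η + μ ^ 2 * p.2)) ⁻¹' S) ∧
    ∀ p ∈ (fun p : ℝ × ℝ => (d + μ * p.1, η + μ ^ 2 * p.2)) ⁻¹' S,
      pderivX (fun x t => u (d + μ * x) (η + μ ^ 2 * t) / μ + ε * t) p.1 p.2 =
        pderivX u (d + μ * p.1) (η + μ ^ 2 * p.2) ∧
      pderivXX (fun x t => u (d + μ * x) (η + μ ^ 2 * t) / μ + ε * t) p.1 p.2 =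
        μ * pderivXX u (d + μ * p.1) (η + μ ^ 2 * p.2) ∧
      pderivT (fun x t => u (d + μ * x) (η + μ ^ 2 * t) / μ + ε * t) p.1 p.2 =
        μ * pderivT u (d + μ * p.1) (η + μ ^ 2 * p.2) + ε := by
  have key : ∀ (f : ℝ → ℝ) (x : ℝ), deriv (fun y => f (d + μ * y)) x = μ * deriv f (d + μ * x) := by
    intro f x
    have := deriv_comp_mul_left μ (fun y => f (d + y)) x
    simpa [deriv_comp_const_add] using this
  set w : ℝ → ℝ → ℝ := fun x t => u (d + μ * x) (η + μ ^ 2 * t) / μ + ε * t with hw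
  have hX : ∀ x t, pderivX w x t = pderivX u (d + μ * x) (η + μ ^ 2 * t) := fun x t => by
    simp only [pderivX, hw]
    rw [deriv_add_const, deriv_div_const, key (fun y => u y (η + μ ^ 2 * t)),
      mul_div_cancel_left₀ _ hμ]
  have hXX : ∀ x t, pderivXX w x t = μ * pderivXX u (d + μ * x) (η + μ ^ 2 * t) := fun x t => by
    simp only [pderivXX, hX]
    exact key (fun y => pderivX u y (η + μ ^ 2 * t)) x
  set Φ : ℝ × ℝ → ℝ × ℝ := fun p => (d + μ * p.1, η + μ ^ 2 * p.2) with hΦ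
  have hΦc : Continuous Φ := by fun_prop
  have hmaps : MapsTo Φ (Φ ⁻¹' S) S := fun p hp => hp
  have hTd : ∀ p ∈ Φ ⁻¹' S, HasDerivAt (fun s => w p.1 s)
      (μ * pderivT u (d + μ * p.1) (η + μ ^ 2 * p.2) + ε) p.2 := by
    intro p hp
    have h1 : HasDerivAt (fun s => u (d + μ * p.1) s)
      (pderivT u (d + μ * p.1) (η + μ ^ 2 * p.2)) (η + μ ^ 2 * p.2) :=
        (hu.2.2.2.1 _ hp).hasDerivAt
    have h2 : HasDerivAt (fun s : ℝ => η + μ ^ 2 * s) (μ ^ 2) p.2 := by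
      simpa using ((hasDerivAt_id p.2).const_mul (μ ^ 2)).const_add η
    have h3 : HasDerivAt (fun s : ℝ => ε * s) ε p.2 := by
      simpa using (hasDerivAt_id p.2).const_mul ε
    refine (((h1.comp p.2 h2).div_const μ).add h3).congr_deriv ?_
    field_simp
  have hT := fun p hp => (hTd p hp).deriv
  have hlin : ∀ x, DifferentiableAt ℝ (fun y : ℝ => d + μ * y) x := fun x => by fun_prop
  refine ⟨⟨?_, fun p hp => ?_, fun p hp => ?_, fun p hp => (hTd p hp).differentiableAt, ?_, ?_,
    ?_⟩, fun p hp => ⟨hX _ _, hXX _ _, hT p hp⟩⟩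
  · exact ((hu.1.comp hΦc.continuousOn hmaps).div_const μ).add (by fun_prop)
  · have h1 : DifferentiableAt ℝ (fun y => u y (η + μ ^ 2 * p.2)) (d + μ * p.1) := hu.2.1 _ hp
    exact ((h1.comp p.1 (hlin p.1)).div_const μ).add_const _
  · simp only [hX]
    have h1 : DifferentiableAt ℝ (fun y => pderivX u y (η + μ ^ 2 * p.2)) (d + μ * p.1) :=
      hu.2.2.1 _ hp
    exact h1.comp p.1 (hlin p.1)
  · simp only [hX]
    exact hu.2.2.2.2.1.comp hΦc.continuousOn hmaps
  · simp only [hXX]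
    exact continuousOn_const.mul (hu.2.2.2.2.2.1.comp hΦc.continuousOn hmaps)
  · exact ((continuousOn_const.mul (hu.2.2.2.2.2.2.comp hΦc.continuousOn hmaps)).add
      continuousOn_const).congr hT

/-- Every member of the class `MemS` can be perturbed to a strict supersolution which is regular up
to the boundary: dilate about the centre, shift in time and add a small multiple of `t`. -/
lemma MemS.exists_regular_strict {α : ℝ → ℝ} {L : ℝ} (hL : 0 < L) {ψ : ℝ → ℝ}
    (hψconc : ConcaveOn ℝ (Ioo 0 (L / 2)) ψ) (hψpos : ∀ z ∈ Ioo (0 : ℝ) (L / 2), 0 < ψ z)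
    {φ : ℝ → ℝ → ℝ} (hφ : MemS α L ψ φ) {z t₀ ℓ : ℝ} (hz : z ∈ Ioo 0 (L / 2)) (ht₀ : 0 ≤ t₀)
    (hlt : φ z t₀ < ℓ) :
    ∃ (u : ℝ → ℝ → ℝ) (Ω : Set (ℝ × ℝ)) (T ε : ℝ), IsOpen Ω ∧ RegularOn u Ω ∧ t₀ < T ∧
      Icc 0 (L / 2) ×ˢ Icc 0 T ⊆ Ω ∧ (∀ p ∈ Icc 0 (L / 2) ×ˢ Icc 0 T, 0 ≤ u p.1 p.2) ∧ 0 < ε ∧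
      (∀ p ∈ Icc 0 (L / 2) ×ˢ Icc 0 T,
        α (pderivX u p.1 p.2) * pderivXX u p.1 p.2 + ε ≤ pderivT u p.1 p.2) ∧
      (∀ z ∈ Ioo 0 (L / 2), ψ z ≤ u z 0) ∧ ∀ t ∈ Icc t₀ T, u z t < ℓ := by
  obtain ⟨hφ0, hφc, hφr, hφs, hφψ⟩ := hφ
  set a := L / 2 with ha
  have ha0 : 0 < a := by positivity
  set c := a / 2 with hc
  have hcI : c ∈ Ioo 0 a := ⟨by positivity, by simp only [hc]; linarith⟩
  have hψc := hψpos c hcI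
  set D : Set (ℝ × ℝ) := (Icc 0 a ×ˢ Ici 0) \ {((0 : ℝ), (0 : ℝ)), (a, (0 : ℝ))} with hD
  have hDmem : ∀ w ∈ Ioo 0 a, ∀ t, 0 ≤ t → (w, t) ∈ D := fun w hw t ht =>
    ⟨⟨Ioo_subset_Icc_self hw, ht⟩, by
      simp only [mem_insert_iff, mem_singleton_iff, Prod.mk.injEq]
      rintro (h | h)
      · exact hw.1.ne' h.1
      · exact hw.2.ne h.1⟩
  have hX : ∀ μ ∈ Ioo (0 : ℝ) 1, ∀ w ∈ Icc 0 a, (1 - μ) * c + μ * w ∈ Ioo 0 a := by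
    intro μ hμ w hw
    have h1 : 0 < (1 - μ) * c := mul_pos (by linarith [hμ.2]) hcI.1
    have h2 : 0 ≤ μ * w := mul_nonneg hμ.1.le hw.1
    have h3 : (1 - μ) * c < (1 - μ) * a := mul_lt_mul_of_pos_left hcI.2 (by linarith [hμ.2])
    have h4 : μ * w ≤ μ * a := mul_le_mul_of_nonneg_left hw.2 hμ.1.le
    exact ⟨by linarith, by linarith⟩
  obtain ⟨μ, hμ, hμlt⟩ : ∃ μ ∈ Ioo (0 : ℝ) 1, φ ((1 - μ) * c + μ * z) (0 + μ ^ 2 * t₀) / μ < ℓ := by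
    have h1 : Tendsto (fun μ : ℝ => ((1 - μ) * c + μ * z, 0 + μ ^ 2 * t₀)) (nhdsWithin 1 (Iio 1))
        (nhds (z, t₀)) :=
      (Continuous.tendsto' (by fun_prop) _ _ (by simp)).mono_left nhdsWithin_le_nhds
    have hI : ∀ᶠ μ : ℝ in nhdsWithin 1 (Iio 1), μ ∈ Ioo (0 : ℝ) 1 := Ioo_mem_nhdsLT one_pos
    have h2 : Tendsto (fun μ : ℝ => ((1 - μ) * c + μ * z, 0 + μ ^ 2 * t₀)) (nhdsWithin 1 (Iio 1))
        (nhdsWithin (z, t₀) D) := by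
      refine tendsto_nhdsWithin_iff.2 ⟨h1, hI.mono fun μ hμ => ?_⟩
      exact hDmem _ (hX μ hμ z (Ioo_subset_Icc_self hz)) _ (by positivity)
    have h3 := (Tendsto.comp (hφc (z, t₀) (hDmem z hz t₀ ht₀)) h2).div
      (tendsto_id.mono_left nhdsWithin_le_nhds) one_ne_zero
    rw [div_one] at h3
    obtain ⟨μ, h4, h5⟩ := (hI.and (h3.eventually_lt_const hlt)).exists
    exact ⟨μ, h4, h5⟩
  have hμ0 := hμ.1
  set d := (1 - μ) * c with hd
  have hXμ : ∀ w ∈ Icc 0 a, d + μ * w ∈ Ioo 0 a := hX μ hμ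
  obtain ⟨η, hη, hηlt, hηψ⟩ : ∃ η > 0, φ (d + μ * z) (η + μ ^ 2 * t₀) / μ < ℓ ∧
      ∀ w ∈ Icc 0 a, φ (d + μ * w) 0 - (1 - μ) * ψ c ≤ φ (d + μ * w) η := by
    have hev1 : ∀ᶠ η in nhdsWithin (0 : ℝ) (Ioi 0), φ (d + μ * z) (η + μ ^ 2 * t₀) / μ < ℓ := by
      have h2 : Tendsto (fun η : ℝ => (d + μ * z, η + μ ^ 2 * t₀)) (nhdsWithin 0 (Ioi 0))
          (nhdsWithin (d + μ * z, 0 + μ ^ 2 * t₀) D) := by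
        refine tendsto_nhdsWithin_iff.2 ⟨(Continuous.tendsto (by fun_prop) _).mono_left
          nhdsWithin_le_nhds, ?_⟩
        filter_upwards [self_mem_nhdsWithin] with η hη
        have : (0 : ℝ) < η := hη
        exact hDmem _ (hXμ z (Ioo_subset_Icc_self hz)) _ (by positivity)
      have h3 := (Tendsto.comp (hφc _ (hDmem _ (hXμ z (Ioo_subset_Icc_self hz)) _
        (by positivity : 0 ≤ 0 + μ ^ 2 * t₀))) h2).div_const μ
      exact h3.eventually_lt_const hμlt
    have hev2 : ∀ᶠ η in nhdsWithin (0 : ℝ) (Ioi 0),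
        ∀ w ∈ Icc 0 a, φ (d + μ * w) 0 - (1 - μ) * ψ c ≤ φ (d + μ * w) η := by
      have hcont : ContinuousOn (fun p : ℝ × ℝ => φ (d + μ * p.1) p.2) (Icc 0 a ×ˢ Icc 0 1) :=
        hφc.comp (f := fun p : ℝ × ℝ => (d + μ * p.1, p.2)) (by fun_prop)
          fun p hp => hDmem _ (hXμ _ hp.1) _ hp.2.1
      obtain ⟨δ, hδ, huc⟩ := Metric.uniformContinuousOn_iff.1
        ((isCompact_Icc.prod isCompact_Icc).uniformContinuousOn_of_continuous hcont)
        ((1 - μ) * ψ c) (mul_pos (by linarith [hμ.2]) hψc)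
      filter_upwards [Ioo_mem_nhdsGT (lt_min hδ one_pos)] with η hη w hw
      have hη' := lt_min_iff.1 hη.2
      have h1 := huc (w, η) ⟨hw, hη.1.le, hη'.2.le⟩ (w, 0) ⟨hw, le_rfl, zero_le_one⟩ (by
        rw [Prod.dist_eq, dist_self, Real.dist_eq, sub_zero, abs_of_pos hη.1]
        exact max_lt hδ hη'.1)
      rw [Real.dist_eq, abs_lt] at h1
      simp only at h1
      linarith [h1.1]
    obtain ⟨η, h1, h2, h3⟩ := ((eventually_mem_nhdsWithin (s := Ioi (0 : ℝ))).and (hev1.and hev2)).exists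
    exact ⟨η, h1, h2, h3⟩
  obtain ⟨ε, hε, hεlt⟩ : ∃ ε > 0, φ (d + μ * z) (η + μ ^ 2 * t₀) / μ + ε * t₀ < ℓ := by
    have h1 : Tendsto (fun ε : ℝ => φ (d + μ * z) (η + μ ^ 2 * t₀) / μ + ε * t₀)
        (nhdsWithin 0 (Ioi 0)) (nhds (φ (d + μ * z) (η + μ ^ 2 * t₀) / μ)) :=
      (Continuous.tendsto' (by fun_prop) _ _ (by simp)).mono_left nhdsWithin_le_nhds
    obtain ⟨ε, h2, h3⟩ := ((eventually_mem_nhdsWithin (s := Ioi (0 : ℝ))).and (h1.eventually_lt_const hηlt)).exists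
    exact ⟨ε, h2, h3⟩
  obtain ⟨hureg, huder⟩ := hφr.rescale (d := d) (η := η) (ε := ε) hμ0.ne'
  set u : ℝ → ℝ → ℝ := fun x t => φ (d + μ * x) (η + μ ^ 2 * t) / μ + ε * t with hu
  set Ω := (fun p : ℝ × ℝ => (d + μ * p.1, η + μ ^ 2 * p.2)) ⁻¹' (Ioo 0 a ×ˢ Ioi 0) with hΩdef
  have hΩ : IsOpen Ω := (isOpen_Ioo.prod isOpen_Ioi).preimage (by fun_prop)
  have hmemΩ : ∀ w ∈ Icc 0 a, ∀ t, 0 ≤ t → (w, t) ∈ Ω := fun w hw t ht =>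
    ⟨hXμ w hw, by simp only [mem_Ioi]; positivity⟩
  have hzΩ := hmemΩ z (Ioo_subset_Icc_self hz) t₀ ht₀
  obtain ⟨T, hT, hTlt⟩ : ∃ T > t₀, ∀ t ∈ Icc t₀ T, u z t < ℓ := by
    have hcont : ContinuousAt (fun t => u z t) t₀ :=
      (hureg.2.2.2.1 _ hzΩ).continuousAt
    have h1 := hcont.eventually_lt_const hεlt
    obtain ⟨T, hT, h2⟩ := mem_nhdsGE_iff_exists_Icc_subset.1 (mem_nhdsWithin_of_mem_nhds h1)
    exact ⟨T, hT, fun t ht => h2 ht⟩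
  refine ⟨u, Ω, T, ε, hΩ, hureg, hT, fun p hp => hmemΩ _ hp.1 _ hp.2.1, fun p hp => ?_, hε,
    fun p hp => ?_, fun w hw => ?_, hTlt⟩
  · have h0 := hp.2.1
    have := hφ0 (d + μ * p.1) (η + μ ^ 2 * p.2) (Ioo_subset_Icc_self (hXμ _ hp.1)) (by positivity)
    exact add_nonneg (div_nonneg this hμ0.le) (mul_nonneg hε.le h0)
  · have hpΩ : p ∈ Ω := hmemΩ _ hp.1 _ hp.2.1
    obtain ⟨h1, h2, h3⟩ := huder p hpΩ
    rw [h1, h2, h3]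
    have := mul_le_mul_of_nonneg_left (hφs _ _ hpΩ.1 hpΩ.2) hμ0.le
    simp only at this
    linarith
  · have hwc := Ioo_subset_Icc_self hw
    have h1 := hψconc.2 hcI hw (by linarith [hμ.2] : 0 ≤ 1 - μ) hμ0.le (by ring)
    simp only [smul_eq_mul] at h1
    have h2 := hφψ _ (hXμ w hwc)
    have h3 := hηψ w hwc
    have h4 : μ * ψ w ≤ φ (d + μ * w) η := by linarith
    simp only [hu, mul_zero, add_zero]
    rw [le_div_iff₀ hμ0]
    linarith

theorem psiPlus_concave
    (α : ℝ → ℝ) (hα : Continuous α) (hαpos : ∀ p, 0 < α p)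
    (L : ℝ) (hL : 0 < L) (ψ : ℝ → ℝ)
    (hψc : ContinuousOn ψ (Ioo 0 (L/2)))
    (hψconc : ConcaveOn ℝ (Ioo 0 (L/2)) ψ)
    (hψpos : ∀ z ∈ Ioo (0:ℝ) (L/2), 0 < ψ z) :
    ∀ t : ℝ, 0 ≤ t → ConcaveOn ℝ (Ioo 0 (L/2)) (fun z => psiPlus α L ψ z t) := by
  intro t ht
  refine ⟨convex_Ioo _ _, ?_⟩
  suffices H : ∀ x ∈ Ioo 0 (L / 2), ∀ y ∈ Ioo 0 (L / 2), x < y → ∀ c d : ℝ, 0 < c → 0 < d →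
      c + d = 1 →
      c * psiPlus α L ψ x t + d * psiPlus α L ψ y t ≤ psiPlus α L ψ (c * x + d * y) t by
    intro x hx y hy c d hc hd hcd
    simp only [smul_eq_mul]
    rcases hc.eq_or_lt with rfl | hc
    · obtain rfl : d = 1 := by linarith
      simp
    rcases hd.eq_or_lt with rfl | hd
    · obtain rfl : c = 1 := by linarith
      simp
    rcases lt_trichotomy x y with h | rfl | h
    · exact H x hx y hy h c d hc hd hcd
    · rw [← add_mul, ← add_mul, hcd, one_mul, one_mul]
    · rw [add_comm, add_comm (c * x)]
      exact H y hy x hx h d c hd hc (by rw [add_comm, hcd])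
  intro x hx y hy hxy c d hc hd hcd
  by_cases hne : ∃ φ, MemS α L ψ φ
  swap
  · have h0 : ∀ z, psiPlus α L ψ z t = 0 := fun z => by
      have : {y : ℝ | ∃ φ : ℝ → ℝ → ℝ, MemS α L ψ φ ∧ φ z t = y} = ∅ :=
        eq_empty_of_forall_notMem fun y hy => hne ⟨hy.choose, hy.choose_spec.1⟩
      rw [psiPlus, this, Real.sInf_empty]
    simp [h0]
  obtain ⟨φ₀, hφ₀⟩ := hne
  refine le_csInf ⟨_, φ₀, hφ₀, rfl⟩ ?_
  rintro _ ⟨φ, hφ, rfl⟩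
  by_contra! hlt
  have hz : c * x + d * y ∈ Ioo 0 (L / 2) := convex_Ioo _ _ hx hy hc.le hd.le hcd
  set X := psiPlus α L ψ x t
  set Y := psiPlus α L ψ y t
  set z := c * x + d * y
  -- the chord lowered so that it still exceeds `φ` at `z`
  set κ : ℝ := (c * X + d * Y - φ z t) / 2 with hκ
  have hκ0 : 0 < κ := by simp only [hκ]; linarith
  set b : ℝ := (Y - X) / (y - x) with hb
  have hbxy : b * (y - x) = Y - X := div_mul_cancel₀ _ (sub_pos.2 hxy).ne'
  set A : ℝ := X - κ - b * x with hA
  have hAx : A + b * x = X - κ := by simp only [hA]; ring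
  have hAy : A + b * y = Y - κ := by simp only [hA]; linear_combination hbxy
  have hAz : A + b * z = c * X + d * Y - κ := by
    simp only [z]; linear_combination c * hAx + d * hAy - (A + κ) * hcd
  have hφz : φ z t < A + b * z := by rw [hAz]; linarith
  obtain ⟨u, Ω, T, ε, hΩ, hu, hT, hRΩ, hnn, hε, hsup, hψu, hzu⟩ :=
    hφ.exists_regular_strict hL hψconc hψpos hz ht hφz
  have hxz : x < z := by
    have : z - x = d * (y - x) := by simp only [z]; linear_combination x * hcd
    linarith [mul_pos hd (sub_pos.2 hxy)]
  have hzy : z < y := by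
    have : y - z = c * (y - x) := by simp only [z]; linear_combination (-y) * hcd
    linarith [mul_pos hc (sub_pos.2 hxy)]
  rcases psiPlus_le_affine_or hα hαpos hL hψconc hψpos hΩ hu ht hT hRΩ hnn hε hsup hψu A b
    (Ioo_subset_Icc_self hx) (Ioo_subset_Icc_self hy) hxz hzy hzu with h | h
  · linarith
  · linarith
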